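/- Consider the homogeneous stochastic block model with N nodes, K blocks and probability mass functions f, g on a finite set S, where the node labelling σ is uniformly distributed on {1,…,K}^N and, given σ, the data x has law P_σ. Set I = D_{1/2}(f‖g). Let σ̂ be any estimator satisfying the maximum-likelihood property P_{σ̂(x)}(x) ≥ P_{σ'}(x) for all σ' and all x. Then for all 0 ≤ ε ≤ ζ ≤ 1/21, with κ = 56 max{K² exp(−(1/8) N I / K), K/N}: E Ham*(σ, σ̂(x)) ≤ 8 e N (K−1) exp(−(1 − ζ − κ) N I / K) + N K^N exp(−(1/4)(ζ/(K−1) − ε)(N/K)² I) + 2 N K exp(−(1/3) ε² N / K), where E denotes expectation over both σ and x. -/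

import Mathlib

open Finset

/-- Hamming distance between two node labellings. -/
def ham {N K : ℕ} (σ₁ σ₂ : Fin N → Fin K) : ℕ :=
  (Finset.univ.filter fun i => σ₁ i ≠ σ₂ i).card

/-- Absolute classification error: minimum Hamming distance over relabellings of `σ₂`. -/
def hamStar {N K : ℕ} (σ₁ σ₂ : Fin N → Fin K) : ℕ :=
  Finset.univ.inf' Finset.univ_nonempty fun ρ : Equiv.Perm (Fin K) =>
    ham σ₁ (fun i => ρ (σ₂ i))

/-- Number of nodes with label `k` under the labelling `σ`. -/
def blockCount {N K : ℕ} (σ : Fin N → Fin K) (k : Fin K) : ℕ :=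
  (Finset.univ.filter fun i => σ i = k).card

/-- Index type for unordered pairs of distinct nodes, represented by ordered pairs `i < j`. -/
abbrev PairIdx (N : ℕ) := {p : Fin N × Fin N // p.1 < p.2}

/-- Probability assigned by the homogeneous SBM with labelling `σ`, intra-block interaction
distribution `f` and inter-block interaction distribution `g`, to the data array `x`. -/
noncomputable def sbmProb {N K : ℕ} {S : Type*} [Fintype S] (f g : S → ℝ)
    (σ : Fin N → Fin K) (x : PairIdx N → S) : ℝ :=
  ∏ p : PairIdx N, (if σ p.1.1 = σ p.1.2 then f (x p) else g (x p))

/-- Number of unordered pairs of nodes on which the partitions of `σ` and `τ` disagree. -/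
def mirkin {N K : ℕ} (σ τ : Fin N → Fin K) : ℕ :=
  (univ.filter fun p : PairIdx N => ¬(σ p.1.1 = σ p.1.2 ↔ τ p.1.1 = τ p.1.2)).card

lemma card_ordered_disagree_le {N K : ℕ} (σ τ : Fin N → Fin K) :
    (univ.filter fun q : Fin N × Fin N => ¬(σ q.1 = σ q.2 ↔ τ q.1 = τ q.2)).card
      ≤ 2 * mirkin σ τ := by
  classical
  set D := univ.filter fun p : PairIdx N => ¬(σ p.1.1 = σ p.1.2 ↔ τ p.1.1 = τ p.1.2) with hD
  have hsub : (univ.filter fun q : Fin N × Fin N => ¬(σ q.1 = σ q.2 ↔ τ q.1 = τ q.2)) ⊆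
      D.image (fun p => p.1) ∪ D.image (fun p => p.1.swap) := by
    rintro ⟨i, j⟩ hq
    simp only [mem_filter, mem_univ, true_and] at hq
    rcases lt_trichotomy i j with h | h | h
    · refine mem_union_left _ (mem_image.2 ⟨⟨(i, j), h⟩, ?_, rfl⟩)
      simpa [hD] using hq
    · subst h; simp at hq
    · refine mem_union_right _ (mem_image.2 ⟨⟨(j, i), h⟩, ?_, rfl⟩)
      simp only [hD, mem_filter, mem_univ, true_and]
      rwa [eq_comm, eq_comm (a := τ j)]
  calc _ ≤ _ := card_le_card hsub
    _ ≤ _ := card_union_le _ _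
    _ ≤ D.card + D.card := add_le_add card_image_le card_image_le
    _ = 2 * mirkin σ τ := by rw [mirkin, two_mul]

lemma ham_mul_le_mirkin {N K : ℕ} (σ τ : Fin N → Fin K) (r : ℝ)
    (hr : ∀ k, r ≤ (blockCount σ k : ℝ)) :
    (ham σ τ : ℝ) * (2 * r - ham σ τ) ≤ mirkin σ τ := by
  classical
  set E := univ.filter fun i => σ i ≠ τ i with hE
  set G : Fin N → Finset (Fin N) := fun i =>
    (univ.filter fun j => σ j = σ i ∨ σ j = τ i) \ E with hG
  have hGcard : ∀ i ∈ E, 2 * r - (ham σ τ : ℝ) ≤ ((G i).card : ℝ) := by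
    intro i hi
    have hne : σ i ≠ τ i := by simpa [hE] using hi
    have h1 : (univ.filter fun j => σ j = σ i ∨ σ j = τ i).card =
        blockCount σ (σ i) + blockCount σ (τ i) := by
      rw [filter_or, card_union_of_disjoint]
      · rfl
      · rw [disjoint_filter]
        intro j _ h1 h2
        exact hne (h1.symm.trans h2)
    have h2 : (univ.filter fun j => σ j = σ i ∨ σ j = τ i).card ≤ (G i).card + E.card := by
      have := le_card_sdiff E (univ.filter fun j => σ j = σ i ∨ σ j = τ i)
      simp only [hG]
      omega
    have h3 : (blockCount σ (σ i) + blockCount σ (τ i) : ℝ) ≤ (G i).card + ham σ τ := by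
      rw [h1] at h2
      exact_mod_cast h2
    linarith [hr (σ i), hr (τ i)]
  have hdis : ∀ i ∈ E, ∀ j ∈ G i, ¬(σ i = σ j ↔ τ i = τ j) := by
    intro i hi j hj
    simp only [hG, hE, mem_sdiff, mem_filter, mem_univ, true_and, not_not] at hi hj
    grind
  have hsub : ((E.sigma G).image (fun q => (q.1, q.2))).card = ∑ i ∈ E, (G i).card := by
    rw [card_image_of_injOn, card_sigma]
    rintro ⟨a, b⟩ _ ⟨c, d⟩ _ h
    simp only [Prod.mk.injEq] at h
    obtain ⟨rfl, rfl⟩ := h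
    rfl
  have hsub' : ((E.sigma G).image (fun q => (q.2, q.1))).card = ∑ i ∈ E, (G i).card := by
    rw [card_image_of_injOn, card_sigma]
    rintro ⟨a, b⟩ _ ⟨c, d⟩ _ h
    simp only [Prod.mk.injEq] at h
    obtain ⟨rfl, rfl⟩ := h
    rfl
  have hunion : ((E.sigma G).image (fun q => (q.1, q.2)) ∪
      (E.sigma G).image (fun q => (q.2, q.1))).card
      ≤ (univ.filter fun q : Fin N × Fin N => ¬(σ q.1 = σ q.2 ↔ τ q.1 = τ q.2)).card := by
    apply card_le_card
    rintro ⟨a, b⟩ h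
    simp only [mem_union, mem_image, mem_sigma, Sigma.exists, Prod.mk.injEq] at h
    simp only [mem_filter, mem_univ, true_and]
    rcases h with ⟨i, j, ⟨hi, hj⟩, rfl, rfl⟩ | ⟨i, j, ⟨hi, hj⟩, rfl, rfl⟩
    · exact hdis _ hi _ hj
    · have := hdis _ hi _ hj
      rwa [eq_comm, eq_comm (a := τ j)]
  have hdisj : Disjoint ((E.sigma G).image (fun q => (q.1, q.2)))
      ((E.sigma G).image (fun q => (q.2, q.1))) := by
    rw [disjoint_left]
    rintro ⟨a, b⟩ h h'
    simp only [mem_image, mem_sigma, Sigma.exists, Prod.mk.injEq] at h h'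
    obtain ⟨i, j, ⟨hi, hj⟩, rfl, rfl⟩ := h
    obtain ⟨i', j', ⟨hi', hj'⟩, rfl, rfl⟩ := h'
    simp only [hG, mem_sdiff] at hj
    exact hj.2 hi'
  rw [card_union_of_disjoint hdisj, hsub, hsub'] at hunion
  have hM : ∑ i ∈ E, (G i).card ≤ mirkin σ τ := by
    have := hunion.trans (card_ordered_disagree_le σ τ)
    omega
  calc (ham σ τ : ℝ) * (2 * r - ham σ τ) = ∑ i ∈ E, (2 * r - (ham σ τ : ℝ)) := by
        rw [sum_const, nsmul_eq_mul]; rfl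
    _ ≤ ∑ i ∈ E, ((G i).card : ℝ) := sum_le_sum hGcard
    _ ≤ mirkin σ τ := by exact_mod_cast hM

/-- Number of nodes with label `k` under `σ` and `l` under `τ`. -/
def overlap {N K : ℕ} (σ τ : Fin N → Fin K) (k l : Fin K) : ℕ :=
  (univ.filter fun i => σ i = k ∧ τ i = l).card

lemma blockCount_mul_le_mirkin {N K : ℕ} (σ τ : Fin N → Fin K) (k : Fin K) (c : ℝ)
    (hc : ∀ l, (overlap σ τ k l : ℝ) + c ≤ blockCount σ k) :
    (blockCount σ k : ℝ) * c ≤ 2 * mirkin σ τ := by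
  classical
  set R := univ.filter fun i => σ i = k with hR
  set G : Fin N → Finset (Fin N) := fun i => R \ (univ.filter fun j => σ j = k ∧ τ j = τ i) with hG
  have hcard : ∀ i ∈ R, c ≤ ((G i).card : ℝ) := by
    intro i _
    have h1 : R.card ≤ (G i).card + overlap σ τ k (τ i) := by
      have := le_card_sdiff (univ.filter fun j => σ j = k ∧ τ j = τ i) R
      simp only [hG, overlap]
      omega
    have h2 : (blockCount σ k : ℝ) ≤ (G i).card + overlap σ τ k (τ i) := by exact_mod_cast h1
    linarith [hc (τ i)]
  have himg : ((R.sigma G).image (fun q => (q.1, q.2))).card = ∑ i ∈ R, (G i).card := by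
    rw [card_image_of_injOn, card_sigma]
    rintro ⟨a, b⟩ _ ⟨c, d⟩ _ h
    simp only [Prod.mk.injEq] at h
    obtain ⟨rfl, rfl⟩ := h
    rfl
  have hle : ((R.sigma G).image (fun q => (q.1, q.2))).card
      ≤ (univ.filter fun q : Fin N × Fin N => ¬(σ q.1 = σ q.2 ↔ τ q.1 = τ q.2)).card := by
    apply card_le_card
    rintro ⟨a, b⟩ h
    simp only [mem_image, mem_sigma, Sigma.exists, Prod.mk.injEq] at h
    obtain ⟨i, j, ⟨hi, hj⟩, rfl, rfl⟩ := h
    simp only [hG, hR, mem_sdiff, mem_filter, mem_univ, true_and] at hi hj ⊢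
    grind
  have hM : ∑ i ∈ R, (G i).card ≤ 2 * mirkin σ τ := by
    rw [← himg]
    exact hle.trans (card_ordered_disagree_le σ τ)
  calc (blockCount σ k : ℝ) * c = ∑ i ∈ R, c := by rw [sum_const, nsmul_eq_mul]; rfl
    _ ≤ ∑ i ∈ R, ((G i).card : ℝ) := sum_le_sum hcard
    _ ≤ 2 * mirkin σ τ := by exact_mod_cast hM

lemma overlap_mul_overlap_le_mirkin {N K : ℕ} (σ τ : Fin N → Fin K) {k k' : Fin K} (hk : k ≠ k')
    (l : Fin K) : overlap σ τ k l * overlap σ τ k' l ≤ 2 * mirkin σ τ := by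
  refine le_trans ?_ (card_ordered_disagree_le σ τ)
  rw [overlap, overlap, ← card_product]
  apply card_le_card
  rintro ⟨a, b⟩ h
  simp only [mem_product, mem_filter, mem_univ, true_and] at h ⊢
  grind

lemma ham_add_sum_overlap {N K : ℕ} (σ τ : Fin N → Fin K) (π : Equiv.Perm (Fin K)) :
    ham σ (fun i => π.symm (τ i)) + ∑ k, overlap σ τ k (π k) = ∑ k, blockCount σ k := by
  classical
  have h1 : ∑ k, blockCount σ k = (univ : Finset (Fin N)).card :=
    (card_eq_sum_card_fiberwise (fun i _ => mem_univ (σ i))).symm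
  have h2 : ∑ k, overlap σ τ k (π k) =
      (univ.filter fun i => ¬ σ i ≠ π.symm (τ i)).card := by
    rw [card_eq_sum_card_fiberwise (f := σ) (t := univ) (fun i _ => mem_coe.2 (mem_univ (σ i)))]
    refine sum_congr rfl fun k _ => ?_
    rw [overlap, filter_filter]
    congr 1
    ext i
    simp only [mem_filter, mem_univ, true_and, not_not, Equiv.eq_symm_apply]
    grind
  rw [h1, h2, ham]
  exact card_filter_add_card_filter_not _

lemma hamStar_le {N K : ℕ} (σ τ : Fin N → Fin K) (ρ : Equiv.Perm (Fin K)) :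
    hamStar σ τ ≤ ham σ (fun i => ρ (τ i)) :=
  inf'_le _ (mem_univ ρ)

lemma exists_hamStar_eq {N K : ℕ} (σ τ : Fin N → Fin K) :
    ∃ ρ : Equiv.Perm (Fin K), hamStar σ τ = ham σ (fun i => ρ (τ i)) := by
  obtain ⟨ρ, -, h⟩ := exists_mem_eq_inf' univ_nonempty
    fun ρ : Equiv.Perm (Fin K) => ham σ (fun i => ρ (τ i))
  exact ⟨ρ, h⟩

lemma hamStar_le_card {N K : ℕ} (σ τ : Fin N → Fin K) : hamStar σ τ ≤ N := by
  refine (hamStar_le σ τ 1).trans ((card_filter_le _ _).trans ?_)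
  simp

lemma mirkin_ge_of_lt_hamStar {N K : ℕ} (hK : 2 ≤ K) (σ τ : Fin N → Fin K) (n : ℝ) (hn : 0 ≤ n)
    (hr : ∀ k, 20 / 21 * n ≤ (blockCount σ k : ℝ)) (hlt : n < hamStar σ τ) :
    1 / 2 * (1 / 21 / ((K : ℝ) - 1)) * n ^ 2 ≤ mirkin σ τ := by
  have hK' : (2 : ℝ) ≤ K := by exact_mod_cast hK
  have : Nonempty (Fin K) := ⟨⟨0, by omega⟩⟩
  have hmax : ∀ k, ∃ l, ∀ l', overlap σ τ k l' ≤ overlap σ τ k l :=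
    fun k => Finite.exists_max _
  choose φ hφ using hmax
  have hcoef : 1 / 21 / ((K : ℝ) - 1) ≤ 1 / 21 := by
    rw [div_le_iff₀ (by linarith)]; linarith
  by_cases ha : ∃ k, (overlap σ τ k (φ k) : ℝ) + n / K ≤ blockCount σ k
  · obtain ⟨k, hk⟩ := ha
    have h := blockCount_mul_le_mirkin σ τ k (n / K) fun l => by
      have : (overlap σ τ k l : ℝ) ≤ overlap σ τ k (φ k) := by exact_mod_cast hφ k l
      linarith
    have h2 : 20 / 21 * n * (n / K) ≤ blockCount σ k * (n / K) := by
      have := hr k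
      gcongr
    have h3 : 1 / 21 / ((K : ℝ) - 1) * n ^ 2 ≤ 20 / 21 * n * (n / K) := by
      have : 1 / 21 / ((K : ℝ) - 1) ≤ 20 / 21 / K := by
        rw [div_le_div_iff₀ (by linarith) (by linarith)]; linarith
      calc _ ≤ 20 / 21 / K * n ^ 2 := by gcongr
        _ = _ := by ring
    linarith
  · push Not at ha
    have hov : ∀ k, 19 / 42 * n ≤ overlap σ τ k (φ k) := by
      intro k
      have h1 := ha k
      have h2 := hr k
      have h3 : n / K ≤ n / 2 := by gcongr
      linarith
    by_cases hinj : Function.Injective φ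
    · exfalso
      let π := Equiv.ofBijective φ (Finite.injective_iff_bijective.1 hinj)
      have h1 := ham_add_sum_overlap σ τ π
      have h2 := hamStar_le σ τ π.symm
      have h3 : (ham σ (fun i => π.symm (τ i)) : ℝ) =
          ∑ k, ((blockCount σ k : ℝ) - overlap σ τ k (φ k)) := by
        rw [sum_sub_distrib, eq_sub_iff_add_eq]
        exact_mod_cast h1
      have h4 : ∑ k, ((blockCount σ k : ℝ) - overlap σ τ k (φ k)) ≤ ∑ _k : Fin K, n / K :=
        sum_le_sum fun k _ => by linarith [ha k]
      rw [sum_const, card_univ, Fintype.card_fin, nsmul_eq_mul,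
        mul_div_cancel₀ _ (by linarith : (K : ℝ) ≠ 0)] at h4
      have h5 : (hamStar σ τ : ℝ) ≤ ham σ (fun i => π.symm (τ i)) := by exact_mod_cast h2
      linarith
    · simp only [Function.Injective, not_forall] at hinj
      obtain ⟨k, k', he, hne⟩ := hinj
      have h1 := overlap_mul_overlap_le_mirkin σ τ hne (φ k)
      have h2 : (overlap σ τ k (φ k) : ℝ) * overlap σ τ k' (φ k) ≤ 2 * mirkin σ τ := by
        exact_mod_cast h1
      have h3 : 19 / 42 * n * (19 / 42 * n) ≤
          (overlap σ τ k (φ k) : ℝ) * overlap σ τ k' (φ k) := by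
        have := hov k
        have h' := hov k'
        rw [← he] at h'
        gcongr
      have h4 : 1 / 2 * (1 / 21 / ((K : ℝ) - 1)) * n ^ 2 ≤ 1 / 2 * (1 / 21) * n ^ 2 := by gcongr
      nlinarith [sq_nonneg n]

lemma sum_univ_prod_pi {ι S : Type*} [Fintype ι] [DecidableEq ι] [Fintype S] (h : ι → S → ℝ) :
    ∑ x : ι → S, ∏ i, h i (x i) = ∏ i, ∑ s, h i s := by
  rw [prod_univ_sum, Fintype.piFinset_univ]

lemma sbmProb_nonneg {N K : ℕ} {S : Type*} [Fintype S] {f g : S → ℝ} (hf0 : ∀ x, 0 ≤ f x)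
    (hg0 : ∀ x, 0 ≤ g x) (σ : Fin N → Fin K) (x : PairIdx N → S) : 0 ≤ sbmProb f g σ x :=
  prod_nonneg fun p _ => by split_ifs <;> simp [hf0, hg0]

lemma sum_sbmProb {N K : ℕ} {S : Type*} [Fintype S] {f g : S → ℝ} (hf1 : ∑ x, f x = 1)
    (hg1 : ∑ x, g x = 1) (σ : Fin N → Fin K) : ∑ x, sbmProb f g σ x = 1 := by
  have := sum_univ_prod_pi (ι := PairIdx N)
    (fun p s => if σ p.1.1 = σ p.1.2 then f s else g s)
  simp only [sbmProb]
  rw [this]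
  exact prod_eq_one fun p _ => by split_ifs <;> assumption

lemma sum_sqrt_sbmProb_mul {N K : ℕ} {S : Type*} [Fintype S] {f g : S → ℝ} (hf0 : ∀ x, 0 ≤ f x)
    (hg0 : ∀ x, 0 ≤ g x) (hf1 : ∑ x, f x = 1) (hg1 : ∑ x, g x = 1) (σ τ : Fin N → Fin K) :
    ∑ x, √(sbmProb f g σ x * sbmProb f g τ x) = (∑ x, √(f x * g x)) ^ mirkin σ τ := by
  have h1 : ∀ x : PairIdx N → S, √(sbmProb f g σ x * sbmProb f g τ x) =
      ∏ p : PairIdx N, √((if σ p.1.1 = σ p.1.2 then f (x p) else g (x p)) *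
        (if τ p.1.1 = τ p.1.2 then f (x p) else g (x p))) := by
    intro x
    rw [sbmProb, sbmProb, ← prod_mul_distrib, Real.sqrt_prod]
    intro p _
    apply mul_nonneg <;> split_ifs <;> simp [hf0, hg0]
  simp only [h1]
  rw [sum_univ_prod_pi (ι := PairIdx N) (fun p s => √((if σ p.1.1 = σ p.1.2 then f s else g s) *
        (if τ p.1.1 = τ p.1.2 then f s else g s)))]
  rw [mirkin, ← prod_const, prod_filter]
  refine prod_congr rfl fun p _ => ?_
  by_cases ha : σ p.1.1 = σ p.1.2 <;> by_cases hb : τ p.1.1 = τ p.1.2 <;>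
    simp [ha, hb, Real.sqrt_mul_self, hf0, hg0, hf1, hg1, mul_comm]

lemma sum_sqrt_mul_le_one {S : Type*} [Fintype S] {f g : S → ℝ} (hf0 : ∀ x, 0 ≤ f x)
    (hg0 : ∀ x, 0 ≤ g x) (hf1 : ∑ x, f x = 1) (hg1 : ∑ x, g x = 1) :
    ∑ x, √(f x * g x) ≤ 1 := by
  calc ∑ x, √(f x * g x) ≤ ∑ x, (f x + g x) / 2 := by
        refine sum_le_sum fun x _ => Real.sqrt_le_iff.2 ⟨?_, ?_⟩
        · linarith [hf0 x, hg0 x]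
        · nlinarith [sq_nonneg (f x - g x)]
    _ = 1 := by rw [← sum_div, sum_add_distrib, hf1, hg1]; norm_num

lemma sbmProb_comp_perm {N K : ℕ} {S : Type*} [Fintype S] (f g : S → ℝ) (σ : Fin N → Fin K)
    (ρ : Equiv.Perm (Fin K)) (x : PairIdx N → S) :
    sbmProb f g (fun i => ρ (σ i)) x = sbmProb f g σ x := by
  simp [sbmProb]

lemma card_ham_eq_le {N K : ℕ} (hK : 2 ≤ K) (hN : 0 < N) (σ : Fin N → Fin K) {m : ℕ}
    (hm : 0 < m) :
    ((univ.filter fun τ : Fin N → Fin K => ham σ τ = m).card : ℝ) ≤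
      (Real.exp 1 * N * ((K : ℝ) - 1) / m) ^ m := by
  have hK' : (0 : ℝ) < (K : ℝ) - 1 := by
    have : (2 : ℝ) ≤ K := by exact_mod_cast hK
    linarith
  have hN' : (0 : ℝ) < N := by exact_mod_cast hN
  have hm' : (0 : ℝ) < m := by exact_mod_cast hm
  set t : ℝ := m / (N * ((K : ℝ) - 1)) with ht
  have ht0 : 0 < t := by positivity
  have h1 : ∑ τ : Fin N → Fin K, t ^ ham σ τ = (1 + ((K : ℝ) - 1) * t) ^ N := by
    have h2 : ∀ τ : Fin N → Fin K, t ^ ham σ τ = ∏ i, if σ i ≠ τ i then t else 1 := by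
      intro τ
      rw [ham, ← prod_const, prod_filter]
    simp only [h2]
    rw [sum_univ_prod_pi (fun i k => if σ i ≠ k then t else 1)]
    have h3 : ∀ i, ∑ k, (if σ i ≠ k then t else 1) = 1 + ((K : ℝ) - 1) * t := by
      intro i
      rw [Fintype.sum_eq_add_sum_compl (σ i)]
      have : ∑ k ∈ {σ i}ᶜ, (if σ i ≠ k then t else 1) = ∑ k ∈ ({σ i}ᶜ : Finset (Fin K)), t := by
        refine sum_congr rfl fun k hk => ?_
        rw [if_pos]
        simpa [eq_comm] using hk
      rw [this, sum_const, card_compl, card_singleton, Fintype.card_fin, nsmul_eq_mul,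
        Nat.cast_sub (by omega)]
      simp
    simp only [h3, prod_const, card_univ, Fintype.card_fin]
  have h4 : ((univ.filter fun τ : Fin N → Fin K => ham σ τ = m).card : ℝ) * t ^ m
      ≤ Real.exp m := by
    calc _ = ∑ τ ∈ univ.filter fun τ : Fin N → Fin K => ham σ τ = m, t ^ ham σ τ := by
          rw [← nsmul_eq_mul, ← sum_const]
          refine sum_congr rfl fun τ hτ => ?_
          rw [(mem_filter.1 hτ).2]
      _ ≤ ∑ τ : Fin N → Fin K, t ^ ham σ τ :=
          sum_le_sum_of_subset_of_nonneg (filter_subset _ _) fun _ _ _ => by positivity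
      _ = (1 + ((K : ℝ) - 1) * t) ^ N := h1
      _ ≤ (Real.exp (((K : ℝ) - 1) * t)) ^ N := by
          gcongr
          linarith [Real.add_one_le_exp (((K : ℝ) - 1) * t)]
      _ = Real.exp m := by
          rw [← Real.exp_nat_mul]
          congr 1
          rw [ht]; field_simp
  have h5 : (Real.exp 1 * N * ((K : ℝ) - 1) / m) ^ m * t ^ m = Real.exp m := by
    rw [← mul_pow, Real.exp_one_pow m |>.symm]
    congr 1
    rw [ht]; field_simp
  rw [← h5] at h4
  exact le_of_mul_le_mul_right h4 (by positivity)

lemma exp_sub_le {y : ℝ} (hy : |y| ≤ 1 / 21) :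
    Real.exp y - 1 - y * (1 + y) ≤ -(1 / 3) * y ^ 2 := by
  have h := Real.exp_bound (x := y) (by linarith) (n := 3) (by norm_num)
  have h' := (abs_le.1 h).2
  simp [sum_range_succ, Nat.factorial] at h'
  have h3 : |y| ^ 3 ≤ 1 / 21 * y ^ 2 := by
    rw [pow_succ, sq_abs, mul_comm]
    gcongr
  nlinarith [sq_nonneg y]

/-- Chernoff bound for both tails of a block count, selected by the sign of `y`. -/
lemma sum_blockCount_tail_le {N K : ℕ} (hK : 2 ≤ K) (k : Fin K) {y : ℝ} (hy : |y| ≤ 1 / 21) :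
    ((univ.filter fun σ : Fin N → Fin K =>
        y * ((1 + y) * ((N : ℝ) / K)) ≤ y * blockCount σ k).card : ℝ) ≤
      (K : ℝ) ^ N * Real.exp (-(1 / 3) * y ^ 2 * ((N : ℝ) / K)) := by
  have hK' : (2 : ℝ) ≤ K := by exact_mod_cast hK
  have h1 : ∑ σ : Fin N → Fin K, Real.exp (y * blockCount σ k) =
      ((K : ℝ) - 1 + Real.exp y) ^ N := by
    have h2 : ∀ σ : Fin N → Fin K, Real.exp (y * blockCount σ k) =
        ∏ i, if σ i = k then Real.exp y else 1 := by
      intro σ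
      rw [mul_comm, Real.exp_nat_mul, blockCount, ← prod_const, prod_filter]
    simp only [h2]
    rw [sum_univ_prod_pi (fun (_ : Fin N) l => if l = k then Real.exp y else 1)]
    have h3 : ∑ l, (if l = k then Real.exp y else 1) = (K : ℝ) - 1 + Real.exp y := by
      rw [Fintype.sum_eq_add_sum_compl k]
      have : ∑ l ∈ {k}ᶜ, (if l = k then Real.exp y else 1) =
          ∑ l ∈ ({k}ᶜ : Finset (Fin K)), (1 : ℝ) := by
        refine sum_congr rfl fun l hl => ?_
        rw [if_neg]
        simpa using hl
      rw [this, sum_const, card_compl, card_singleton, Fintype.card_fin, nsmul_eq_mul,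
        Nat.cast_sub (by omega)]
      simp [add_comm]
    simp [h3]
  set c := y * ((1 + y) * ((N : ℝ) / K)) with hc
  have h4 : ((univ.filter fun σ : Fin N → Fin K => c ≤ y * blockCount σ k).card : ℝ) *
      Real.exp c ≤ ((K : ℝ) - 1 + Real.exp y) ^ N := by
    rw [← h1, ← nsmul_eq_mul, ← sum_const]
    refine (sum_le_sum fun σ hσ => ?_).trans
      (sum_le_sum_of_subset_of_nonneg (filter_subset _ _) fun _ _ _ => by positivity)
    exact Real.exp_le_exp.2 (mem_filter.1 hσ).2
  have h5 : ((K : ℝ) - 1 + Real.exp y) ^ N ≤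
      (K : ℝ) ^ N * Real.exp ((Real.exp y - 1) * (N / K)) := by
    have h6 : (K : ℝ) - 1 + Real.exp y ≤ K * Real.exp ((Real.exp y - 1) / K) := by
      have := Real.add_one_le_exp ((Real.exp y - 1) / K)
      calc (K : ℝ) - 1 + Real.exp y = K * ((Real.exp y - 1) / K + 1) := by field_simp; ring
        _ ≤ _ := by gcongr
    calc _ ≤ (K * Real.exp ((Real.exp y - 1) / K)) ^ N := by
          gcongr
          linarith [Real.exp_pos y]
      _ = _ := by
          rw [mul_pow, ← Real.exp_nat_mul]
          congr 2
          ring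
  have h6 : Real.exp ((Real.exp y - 1) * (N / K)) ≤
      Real.exp (-(1 / 3) * y ^ 2 * ((N : ℝ) / K)) * Real.exp c := by
    rw [← Real.exp_add, Real.exp_le_exp, hc]
    have := mul_le_mul_of_nonneg_right (exp_sub_le hy) (by positivity : 0 ≤ (N : ℝ) / K)
    linarith
  refine le_of_mul_le_mul_right (h4.trans (h5.trans ?_)) (Real.exp_pos c)
  rw [mul_assoc]
  gcongr

lemma weighted_term_le {N K m : ℕ} (hK : 2 ≤ K) (hN : 0 < N) (hm : 0 < m) {I ε ζ κ n B M : ℝ}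
    (hI : 0 ≤ I) (hn : n = (N : ℝ) / K) (hζ0 : 0 ≤ ζ) (hεζ : ε ≤ ζ) (hζ : ζ ≤ 1 / 21)
    (hκ1 : 56 * ((K : ℝ) ^ 2 * Real.exp (-(1 / 8) * (n * I))) ≤ κ) (hκ2 : 56 ≤ κ * n)
    (hmn : (m : ℝ) ≤ n)
    (hB : B = Real.exp 1 * N * ((K : ℝ) - 1) * Real.exp (-(1 - ζ - κ) * (n * I)))
    (hBm : 2 * B < m) (hM : m * (2 * ((1 - ε) * n) - m) ≤ M) :
    m * ((Real.exp 1 * N * ((K : ℝ) - 1) / m) ^ m * Real.exp (-(1 / 2) * I * M)) ≤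
      B * (1 / 2) ^ (m - 1) := by
  have hK' : (2 : ℝ) ≤ K := by exact_mod_cast hK
  have hN' : (1 : ℝ) ≤ N := by exact_mod_cast hN
  have hm' : (0 : ℝ) < m := by exact_mod_cast hm
  have hn0 : 0 < n := hm'.trans_le hmn
  have hL : 0 ≤ n * I := by positivity
  have hK1 : (1 : ℝ) ≤ (K : ℝ) - 1 := by linarith
  have hκ0 : 0 ≤ κ := le_trans (by positivity) hκ1
  have hA : 0 < Real.exp 1 * N * ((K : ℝ) - 1) := by positivity
  have hB0 : 0 < B := by rw [hB]; positivity
  set A := Real.exp 1 * N * ((K : ℝ) - 1) with hAdef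
  rcases le_or_gt (m : ℝ) (2 * (κ * n)) with hc | hc
  · have h1 : m * ((1 - ζ - κ) * (n * I)) ≤ 1 / 2 * I * M := by
      have h2 : m * (2 * (n * (1 - ζ - κ))) ≤ M := by
        refine le_trans (mul_le_mul_of_nonneg_left ?_ hm'.le) hM
        nlinarith
      calc m * ((1 - ζ - κ) * (n * I)) = 1 / 2 * I * (m * (2 * (n * (1 - ζ - κ)))) := by ring
        _ ≤ _ := by gcongr
    have h2 : Real.exp (-(1 / 2) * I * M) ≤ Real.exp (-(1 - ζ - κ) * (n * I)) ^ m := by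
      rw [← Real.exp_nat_mul, Real.exp_le_exp]
      linarith
    calc m * ((A / m) ^ m * Real.exp (-(1 / 2) * I * M))
        ≤ m * ((A / m) ^ m * Real.exp (-(1 - ζ - κ) * (n * I)) ^ m) := by gcongr
      _ = m * (B / m) ^ m := by rw [← mul_pow, hB]; ring
      _ = B * (B / m) ^ (m - 1) := by
          obtain ⟨j, rfl⟩ : ∃ j, m = j + 1 := ⟨m - 1, by omega⟩
          rw [Nat.add_sub_cancel, pow_succ]
          field_simp
      _ ≤ B * (1 / 2) ^ (m - 1) := by
          have h3 : B / m ≤ 1 / 2 := by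
            rw [div_le_iff₀ hm']
            linarith
          gcongr ?_ * ?_ ^ _
  · have hm112 : (112 : ℝ) ≤ m := by linarith
    have h1 : m * (19 / 42 * (n * I)) ≤ 1 / 2 * I * M := by
      have h2 : m * (19 / 21 * n) ≤ M := by
        refine le_trans (mul_le_mul_of_nonneg_left ?_ hm'.le) hM
        nlinarith
      calc m * (19 / 42 * (n * I)) = 1 / 2 * I * (m * (19 / 21 * n)) := by ring
        _ ≤ _ := by gcongr
    have h3 : A / m ≤ 1 / 4 * Real.exp (1 / 8 * (n * I)) := by
      have h4 : 112 * (N * K * Real.exp (-(1 / 8) * (n * I))) ≤ m := by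
        have h5 : 2 * (56 * ((K : ℝ) ^ 2 * Real.exp (-(1 / 8) * (n * I))) * n) ≤ 2 * (κ * n) := by
          gcongr
        have h6 : 2 * (56 * ((K : ℝ) ^ 2 * Real.exp (-(1 / 8) * (n * I))) * n) =
            112 * (N * K * Real.exp (-(1 / 8) * (n * I))) := by
          generalize Real.exp (-(1 / 8) * (n * I)) = t
          rw [hn]; field_simp; ring
        linarith
      have h7 : Real.exp (-(1 / 8) * (n * I)) * Real.exp (1 / 8 * (n * I)) = 1 := by
        rw [← Real.exp_add]; simp
      rw [div_le_iff₀ hm']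
      calc A ≤ 3 * N * K := by
            rw [hAdef]
            have := Real.exp_one_lt_d9
            gcongr <;> linarith
        _ ≤ 1 / 4 * (112 * (N * K)) := by nlinarith
        _ = 1 / 4 * (112 * (N * K * Real.exp (-(1 / 8) * (n * I)))) *
              Real.exp (1 / 8 * (n * I)) := by
            rw [show 1 / 4 * (112 * (N * K * Real.exp (-(1 / 8) * (n * I)))) *
              Real.exp (1 / 8 * (n * I)) = 1 / 4 * (112 * (N * K)) *
              (Real.exp (-(1 / 8) * (n * I)) * Real.exp (1 / 8 * (n * I))) by ring, h7, mul_one]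
        _ ≤ 1 / 4 * m * Real.exp (1 / 8 * (n * I)) := by gcongr
        _ = _ := by ring
    have h8 : Real.exp (-(1 / 2) * I * M) ≤
        Real.exp (-(1 / 8) * (n * I)) ^ m * Real.exp (-(n * I)) := by
      rw [← Real.exp_nat_mul, ← Real.exp_add, Real.exp_le_exp]
      have h9 : (112 : ℝ) * (n * I) ≤ m * (n * I) := by gcongr
      linarith
    have h10 : (m : ℝ) ≤ 2 ^ m := by exact_mod_cast Nat.lt_two_pow_self.le
    have h11 : Real.exp (-(n * I)) ≤ B := by
      rw [hB]
      have h12 : 1 ≤ A := by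
        have h13 : (1 : ℝ) ≤ Real.exp 1 := Real.one_le_exp (by norm_num)
        rw [hAdef]
        calc (1 : ℝ) = 1 * 1 * 1 := by norm_num
          _ ≤ _ := by gcongr
      calc Real.exp (-(n * I)) ≤ Real.exp (-(1 - ζ - κ) * (n * I)) := by
            rw [Real.exp_le_exp]
            nlinarith [mul_nonneg hζ0 hL, mul_nonneg hκ0 hL]
        _ ≤ A * _ := le_mul_of_one_le_left (Real.exp_pos _).le h12
    calc m * ((A / m) ^ m * Real.exp (-(1 / 2) * I * M))
        ≤ 2 ^ m * ((1 / 4 * Real.exp (1 / 8 * (n * I))) ^ m *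
          (Real.exp (-(1 / 8) * (n * I)) ^ m * Real.exp (-(n * I)))) := by gcongr
      _ = (2 * (1 / 4) * (Real.exp (1 / 8 * (n * I)) * Real.exp (-(1 / 8) * (n * I)))) ^ m *
          Real.exp (-(n * I)) := by simp only [mul_pow]; ring
      _ = (1 / 2) ^ m * Real.exp (-(n * I)) := by
          rw [← Real.exp_add]
          norm_num
      _ ≤ (1 / 2) ^ (m - 1) * B := by
          refine mul_le_mul ?_ h11 (Real.exp_pos _).le (by positivity)
          exact pow_le_pow_of_le_one (by norm_num) (by norm_num) (Nat.sub_le _ _)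
      _ = _ := mul_comm _ _

/-- Pointwise comparison splitting the error at `a` and `n`, valid where `u` is maximal for the
likelihood `w`. -/
lemma mul_hamStar_le {N K : ℕ} (w : (Fin N → Fin K) → ℝ) (hw : ∀ τ, 0 ≤ w τ)
    (hperm : ∀ (ρ : Equiv.Perm (Fin K)) τ, w (fun i => ρ (τ i)) = w τ) (σ u : Fin N → Fin K)
    (hu : w σ ≤ w u) {a n : ℝ} (ha : 0 ≤ a) :
    w σ * hamStar σ u ≤ a * w σ +
      ∑ τ ∈ univ.filter (fun τ : Fin N → Fin K => a < ham σ τ ∧ (ham σ τ : ℝ) ≤ n),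
        ham σ τ * √(w σ * w τ) +
      N * ∑ τ ∈ univ.filter (fun τ : Fin N → Fin K => n < hamStar σ τ), √(w σ * w τ) := by
  have hs : ∀ τ, w σ ≤ w τ → w σ ≤ √(w σ * w τ) := fun τ h =>
    Real.le_sqrt_of_sq_le (by rw [sq]; exact mul_le_mul_of_nonneg_left h (hw σ))
  have h1 : 0 ≤ a * w σ := mul_nonneg ha (hw σ)
  have h2 : 0 ≤ ∑ τ ∈ univ.filter (fun τ : Fin N → Fin K => a < ham σ τ ∧ (ham σ τ : ℝ) ≤ n),
        ham σ τ * √(w σ * w τ) := sum_nonneg fun _ _ => by positivity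
  have h3 : 0 ≤ N * ∑ τ ∈ univ.filter (fun τ : Fin N → Fin K => n < hamStar σ τ),
      √(w σ * w τ) := mul_nonneg (by positivity) (sum_nonneg fun _ _ => by positivity)
  rcases le_or_gt (hamStar σ u : ℝ) a with hc | hc
  · have : w σ * hamStar σ u ≤ a * w σ := by
      rw [mul_comm a]
      exact mul_le_mul_of_nonneg_left hc (hw σ)
    linarith
  rcases le_or_gt (hamStar σ u : ℝ) n with hd | hd
  · obtain ⟨ρ, hρ⟩ := exists_hamStar_eq σ u
    have h4 := single_le_sum (s := univ.filter
        (fun τ : Fin N → Fin K => a < ham σ τ ∧ (ham σ τ : ℝ) ≤ n))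
      (f := fun τ => (ham σ τ : ℝ) * √(w σ * w τ)) (fun _ _ => by positivity)
      (a := fun i => ρ (u i)) (by simp [← hρ, hc, hd])
    have h5 : w σ * hamStar σ u ≤
        (ham σ (fun i => ρ (u i)) : ℝ) * √(w σ * w (fun i => ρ (u i))) := by
      rw [← hρ, mul_comm]
      gcongr
      exact hs _ (by rw [hperm]; exact hu)
    linarith
  · have h4 := single_le_sum (s := univ.filter (fun τ : Fin N → Fin K => n < hamStar σ τ))
      (f := fun τ => √(w σ * w τ)) (fun _ _ => by positivity) (a := u) (by simp [hd])
    have h5 : w σ * hamStar σ u ≤ N * √(w σ * w u) := by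
      rw [mul_comm]
      have : (hamStar σ u : ℝ) ≤ N := by exact_mod_cast hamStar_le_card σ u
      exact mul_le_mul this (hs _ hu) (hw σ) (by positivity)
    have h6 : N * √(w σ * w u) ≤ N * ∑ τ ∈ univ.filter
        (fun τ : Fin N → Fin K => n < hamStar σ τ), √(w σ * w τ) := by gcongr
    linarith

lemma sum_half_pow_le (N : ℕ) : ∑ m ∈ Icc 1 N, (1 / 2 : ℝ) ^ (m - 1) ≤ 2 := by
  have h : ∑ m ∈ Icc 1 N, (1 / 2 : ℝ) ^ (m - 1) = ∑ j ∈ range N, (1 / 2 : ℝ) ^ j := by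
    rw [range_eq_Ico, ← Ico_succ_right_eq_Icc, Order.succ_eq_add_one, sum_Ico_eq_sum_range,
      sum_Ico_eq_sum_range]
    simp
  rw [h, geom_sum_eq (by norm_num), div_le_iff_of_neg (by norm_num)]
  have : (0 : ℝ) < (1 / 2) ^ N := by positivity
  linarith

lemma sum_ham_mul_exp_mirkin_le {N K : ℕ} (hK : 2 ≤ K) (hN : 0 < N) {I ε ζ κ n B : ℝ}
    (hI : 0 ≤ I) (hn : n = (N : ℝ) / K) (hζ0 : 0 ≤ ζ) (hεζ : ε ≤ ζ) (hζ : ζ ≤ 1 / 21)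
    (hκ1 : 56 * ((K : ℝ) ^ 2 * Real.exp (-(1 / 8) * (n * I))) ≤ κ) (hκ2 : 56 ≤ κ * n)
    (hB : B = Real.exp 1 * N * ((K : ℝ) - 1) * Real.exp (-(1 - ζ - κ) * (n * I)))
    (hB0 : 0 ≤ B) (σ : Fin N → Fin K) (hσ : ∀ k, (1 - ε) * n ≤ (blockCount σ k : ℝ)) :
    ∑ τ ∈ univ.filter (fun τ : Fin N → Fin K => 2 * B < ham σ τ ∧ (ham σ τ : ℝ) ≤ n),
      (ham σ τ : ℝ) * Real.exp (-(1 / 2) * I * mirkin σ τ) ≤ 2 * B := by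
  set Q := univ.filter (fun τ : Fin N → Fin K => 2 * B < ham σ τ ∧ (ham σ τ : ℝ) ≤ n) with hQ
  have hmaps : ∀ τ ∈ Q, ham σ τ ∈ Icc 1 N := by
    intro τ hτ
    have h1 := (mem_filter.1 hτ).2.1
    have h2 : (0 : ℝ) < ham σ τ := by linarith
    have h3 : 0 < ham σ τ := by exact_mod_cast h2
    have h4 : ham σ τ ≤ N := (card_filter_le _ _).trans (by simp)
    exact mem_Icc.2 ⟨h3, h4⟩
  rw [← sum_fiberwise_of_maps_to hmaps]
  calc _ ≤ ∑ m ∈ Icc 1 N, B * (1 / 2 : ℝ) ^ (m - 1) := ?_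
    _ ≤ B * 2 := by
        rw [← mul_sum]
        exact mul_le_mul_of_nonneg_left (sum_half_pow_le N) hB0
    _ = 2 * B := mul_comm _ _
  refine sum_le_sum fun m hm => ?_
  have hm0 : 0 < m := (mem_Icc.1 hm).1
  rcases (Q.filter fun τ => ham σ τ = m).eq_empty_or_nonempty with he | ⟨τ₀, hτ₀⟩
  · rw [he, sum_empty]
    positivity
  obtain ⟨hτQ, hτm⟩ := mem_filter.1 hτ₀
  obtain ⟨hlo, hhi⟩ := (mem_filter.1 hτQ).2
  rw [hτm] at hlo hhi
  set M₀ : ℝ := m * (2 * ((1 - ε) * n) - m) with hM₀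
  have hcard : ((Q.filter fun τ => ham σ τ = m).card : ℝ) ≤
      (Real.exp 1 * N * ((K : ℝ) - 1) / m) ^ m := by
    refine le_trans ?_ (card_ham_eq_le hK hN σ hm0)
    exact_mod_cast card_le_card (filter_subset_filter _ (subset_univ Q))
  calc _ ≤ ∑ τ ∈ Q.filter fun τ => ham σ τ = m, (m : ℝ) * Real.exp (-(1 / 2) * I * M₀) := by
        refine sum_le_sum fun τ hτ => ?_
        have hτm := (mem_filter.1 hτ).2
        have h1 := ham_mul_le_mirkin σ τ _ hσ
        rw [hτm] at h1 ⊢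
        gcongr ?_ * Real.exp ?_
        nlinarith
    _ = m * (((Q.filter fun τ => ham σ τ = m).card : ℝ) * Real.exp (-(1 / 2) * I * M₀)) := by
        rw [sum_const, nsmul_eq_mul]; ring
    _ ≤ m * ((Real.exp 1 * N * ((K : ℝ) - 1) / m) ^ m * Real.exp (-(1 / 2) * I * M₀)) := by
        gcongr
    _ ≤ _ := weighted_term_le hK hN hm0 hI hn hζ0 hεζ hζ hκ1 hκ2 hhi hB hlo le_rfl

lemma sum_exp_mirkin_le {N K : ℕ} (hK : 2 ≤ K) {I ε ζ n : ℝ} (hI : 0 ≤ I) (hn : 0 ≤ n)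
    (hε0 : 0 ≤ ε) (hε : ε ≤ 1 / 21) (hζ : ζ ≤ 1 / 21) (σ : Fin N → Fin K)
    (hσ : ∀ k, (1 - ε) * n ≤ (blockCount σ k : ℝ)) :
    ∑ τ ∈ univ.filter (fun τ : Fin N → Fin K => n < hamStar σ τ),
      Real.exp (-(1 / 2) * I * mirkin σ τ) ≤
      (K : ℝ) ^ N * Real.exp (-(1 / 4) * (ζ / ((K : ℝ) - 1) - ε) * n ^ 2 * I) := by
  have hK' : (2 : ℝ) ≤ K := by exact_mod_cast hK
  calc _ ≤ ∑ τ ∈ univ.filter (fun τ : Fin N → Fin K => n < hamStar σ τ),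
        Real.exp (-(1 / 4) * (ζ / ((K : ℝ) - 1) - ε) * n ^ 2 * I) := by
        refine sum_le_sum fun τ hτ => Real.exp_le_exp.2 ?_
        have h1 := mirkin_ge_of_lt_hamStar hK σ τ n hn
          (fun k => le_trans (by nlinarith) (hσ k)) (mem_filter.1 hτ).2
        have h2 : ζ / ((K : ℝ) - 1) - ε ≤ 1 / 21 / ((K : ℝ) - 1) := by
          have : ζ / ((K : ℝ) - 1) ≤ 1 / 21 / ((K : ℝ) - 1) :=
            div_le_div_of_nonneg_right hζ (by linarith)
          linarith
        have h3 : 1 / 2 * (ζ / ((K : ℝ) - 1) - ε) * n ^ 2 ≤ mirkin σ τ :=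
          le_trans (by gcongr) h1
        have h4 := mul_le_mul_of_nonneg_left h3 hI
        linarith
    _ ≤ _ := by
        rw [sum_const, nsmul_eq_mul]
        gcongr
        have h := card_filter_le (univ : Finset (Fin N → Fin K)) (fun τ => n < hamStar σ τ)
        rw [card_univ, Fintype.card_fun, Fintype.card_fin, Fintype.card_fin] at h
        exact_mod_cast h

lemma balanced_error_le {N K : ℕ} {S : Type*} [Fintype S] {f g : S → ℝ}
    (hf0 : ∀ x, 0 ≤ f x) (hg0 : ∀ x, 0 ≤ g x) (hf1 : ∑ x, f x = 1) (hg1 : ∑ x, g x = 1)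
    {I ε ζ κ n B : ℝ} (hb : ∑ x, √(f x * g x) = Real.exp (-(1 / 2) * I))
    {σhat : (PairIdx N → S) → (Fin N → Fin K)}
    (hMLE : ∀ x : PairIdx N → S, ∀ σ' : Fin N → Fin K,
      sbmProb f g (σhat x) x ≥ sbmProb f g σ' x)
    (hK : 2 ≤ K) (hN : 0 < N) (hI : 0 ≤ I) (hn : n = (N : ℝ) / K) (hε0 : 0 ≤ ε) (hεζ : ε ≤ ζ)
    (hζ : ζ ≤ 1 / 21)
    (hκ1 : 56 * ((K : ℝ) ^ 2 * Real.exp (-(1 / 8) * (n * I))) ≤ κ) (hκ2 : 56 ≤ κ * n)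
    (hB : B = Real.exp 1 * N * ((K : ℝ) - 1) * Real.exp (-(1 - ζ - κ) * (n * I)))
    (hB0 : 0 ≤ B) (σ : Fin N → Fin K) (hσ : ∀ k, (1 - ε) * n ≤ (blockCount σ k : ℝ)) :
    ∑ x, sbmProb f g σ x * (hamStar σ (σhat x) : ℝ) ≤ 4 * B +
      N * ((K : ℝ) ^ N * Real.exp (-(1 / 4) * (ζ / ((K : ℝ) - 1) - ε) * n ^ 2 * I)) := by
  have hsq : ∀ τ : Fin N → Fin K, ∑ x, √(sbmProb f g σ x * sbmProb f g τ x) =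
      Real.exp (-(1 / 2) * I * mirkin σ τ) := by
    intro τ
    rw [sum_sqrt_sbmProb_mul hf0 hg0 hf1 hg1, hb, ← Real.exp_nat_mul, mul_comm]
  calc _ ≤ ∑ x, (2 * B * sbmProb f g σ x +
      ∑ τ ∈ univ.filter (fun τ : Fin N → Fin K => 2 * B < ham σ τ ∧ (ham σ τ : ℝ) ≤ n),
        ham σ τ * √(sbmProb f g σ x * sbmProb f g τ x) +
      N * ∑ τ ∈ univ.filter (fun τ : Fin N → Fin K => n < hamStar σ τ),
        √(sbmProb f g σ x * sbmProb f g τ x)) :=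
        sum_le_sum fun x _ => mul_hamStar_le (fun τ => sbmProb f g τ x)
          (fun τ => sbmProb_nonneg hf0 hg0 τ x) (fun ρ τ => sbmProb_comp_perm f g τ ρ x)
          σ (σhat x) (hMLE x σ) (by positivity)
    _ = 2 * B + ∑ τ ∈ univ.filter (fun τ : Fin N → Fin K =>
          2 * B < ham σ τ ∧ (ham σ τ : ℝ) ≤ n),
          (ham σ τ : ℝ) * Real.exp (-(1 / 2) * I * mirkin σ τ) +
        N * ∑ τ ∈ univ.filter (fun τ : Fin N → Fin K => n < hamStar σ τ),
          Real.exp (-(1 / 2) * I * mirkin σ τ) := by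
        rw [sum_add_distrib, sum_add_distrib, ← mul_sum, sum_sbmProb hf1 hg1, mul_one, sum_comm,
          ← mul_sum, sum_comm (s := univ)]
        simp only [← mul_sum, hsq]
    _ ≤ 2 * B + 2 * B +
      N * ((K : ℝ) ^ N * Real.exp (-(1 / 4) * (ζ / ((K : ℝ) - 1) - ε) * n ^ 2 * I)) := by
        gcongr
        · exact sum_ham_mul_exp_mirkin_le hK hN hI hn (hε0.trans hεζ) hεζ hζ hκ1 hκ2 hB hB0 σ hσ
        · exact sum_exp_mirkin_le hK hI (by rw [hn]; positivity) hε0 (hεζ.trans hζ) hζ σ hσ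
    _ = _ := by ring

lemma card_unbalanced_le {N K : ℕ} (hK : 2 ≤ K) {ε : ℝ} (hε0 : 0 ≤ ε) (hε : ε ≤ 1 / 21) :
    ((univ.filter fun σ : Fin N → Fin K =>
        ¬∀ k, (1 - ε) * ((N : ℝ) / K) ≤ blockCount σ k).card : ℝ) ≤
      K * ((K : ℝ) ^ N * Real.exp (-(1 / 3) * ε ^ 2 * ((N : ℝ) / K))) := by
  classical
  have hsub : (univ.filter fun σ : Fin N → Fin K =>
        ¬∀ k, (1 - ε) * ((N : ℝ) / K) ≤ blockCount σ k) ⊆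
      univ.biUnion fun k => univ.filter fun σ : Fin N → Fin K =>
        -ε * ((1 + -ε) * ((N : ℝ) / K)) ≤ -ε * blockCount σ k := by
    intro σ hσ
    simp only [mem_filter, mem_univ, true_and, not_forall, not_le, mem_biUnion] at hσ ⊢
    obtain ⟨k, hk⟩ := hσ
    exact ⟨k, by nlinarith [mul_le_mul_of_nonneg_left hk.le hε0]⟩
  have h1 := (card_le_card hsub).trans card_biUnion_le
  have h2 : ∀ k : Fin K, _ := fun k => sum_blockCount_tail_le (N := N) hK k (y := -ε)
    (by rwa [abs_neg, abs_of_nonneg hε0])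
  calc _ ≤ ∑ k : Fin K, ((univ.filter fun σ : Fin N → Fin K =>
        -ε * ((1 + -ε) * ((N : ℝ) / K)) ≤ -ε * blockCount σ k).card : ℝ) := by exact_mod_cast h1
    _ ≤ ∑ _k : Fin K, (K : ℝ) ^ N * Real.exp (-(1 / 3) * (-ε) ^ 2 * ((N : ℝ) / K)) :=
        sum_le_sum fun k _ => h2 k
    _ = _ := by simp

lemma sum_sbmProb_mul_hamStar_le {N K : ℕ} {S : Type*} [Fintype S] {f g : S → ℝ}
    (hf0 : ∀ x, 0 ≤ f x) (hg0 : ∀ x, 0 ≤ g x) (hf1 : ∑ x, f x = 1) (hg1 : ∑ x, g x = 1)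
    (σhat : (PairIdx N → S) → (Fin N → Fin K)) (σ : Fin N → Fin K) :
    ∑ x, sbmProb f g σ x * (hamStar σ (σhat x) : ℝ) ≤ N := by
  calc _ ≤ ∑ x, sbmProb f g σ x * (N : ℝ) := by
        refine sum_le_sum fun x _ => mul_le_mul_of_nonneg_left ?_ (sbmProb_nonneg hf0 hg0 σ x)
        exact_mod_cast hamStar_le_card σ (σhat x)
    _ = N := by rw [← sum_mul, sum_sbmProb hf1 hg1, one_mul]

/-- A uniform average over labellings, bounded on and off the labellings satisfying `P`. -/
lemma average_le_add {N K : ℕ} (hK : 0 < K) (P : (Fin N → Fin K) → Prop) [DecidablePred P]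
    {h : (Fin N → Fin K) → ℝ} {A C : ℝ} (hA : 0 ≤ A) (hP : ∀ σ, P σ → h σ ≤ A)
    (hC : ∀ σ, h σ ≤ C) :
    ((K : ℝ) ^ N)⁻¹ * ∑ σ, h σ ≤
      A + ((K : ℝ) ^ N)⁻¹ * (C * (univ.filter fun σ => ¬P σ).card) := by
  have hK' : (0 : ℝ) < (K : ℝ) ^ N := by positivity
  calc _ ≤ ((K : ℝ) ^ N)⁻¹ * ∑ σ, (A + if ¬P σ then C else 0) := by
        refine mul_le_mul_of_nonneg_left (sum_le_sum fun σ _ => ?_) (by positivity)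
        split_ifs with hσ
        · simpa using hP σ hσ
        · linarith [hC σ]
    _ = _ := by
        rw [sum_add_distrib, sum_const, card_univ, Fintype.card_fun, Fintype.card_fin,
          Fintype.card_fin, ← sum_filter, sum_const, nsmul_eq_mul, nsmul_eq_mul]
        push_cast
        field_simp

/-- Upper bound on the expected classification error (averaged over the uniform prior on
labellings) of any maximum-likelihood estimator for a homogeneous SBM. -/
theorem mle_upper_bound_average
    (N K : ℕ) (S : Type*) [Fintype S]
    (f g : S → ℝ) (hf0 : ∀ x, 0 ≤ f x) (hg0 : ∀ x, 0 ≤ g x)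
    (hf1 : ∑ x, f x = 1) (hg1 : ∑ x, g x = 1)
    (I : ℝ) (hI : I = -2 * Real.log (∑ x, Real.sqrt (f x * g x)))
    (σhat : (PairIdx N → S) → (Fin N → Fin K))
    (hMLE : ∀ x : PairIdx N → S, ∀ σ' : Fin N → Fin K,
      sbmProb f g (σhat x) x ≥ sbmProb f g σ' x)
    (ε ζ : ℝ) (hε0 : 0 ≤ ε) (hεζ : ε ≤ ζ) (hζ : ζ ≤ 1 / 21)
    (κ : ℝ)
    (hκ : κ = 56 * max ((K : ℝ) ^ 2 * Real.exp (-(1 / 8) * ((N : ℝ) * I / K)))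
      ((K : ℝ) / N)) :
    (∑ σ : Fin N → Fin K, ∑ x : PairIdx N → S,
        ((K : ℝ) ^ N)⁻¹ * sbmProb f g σ x * (hamStar σ (σhat x) : ℝ))
      ≤ 8 * Real.exp 1 * N * ((K : ℝ) - 1) *
          Real.exp (-(1 - ζ - κ) * ((N : ℝ) * I / K))
        + (N : ℝ) * (K : ℝ) ^ N *
          Real.exp (-(1 / 4) * (ζ / ((K : ℝ) - 1) - ε) * ((N : ℝ) / K) ^ 2 * I)
        + 2 * (N : ℝ) * K * Real.exp (-(1 / 3) * ε ^ 2 * (N : ℝ) / K) := by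
  simp only [mul_assoc ((K : ℝ) ^ N)⁻¹, ← mul_sum]
  rcases Nat.eq_zero_or_pos N with rfl | hN
  · have h0 : ∀ σ τ : Fin 0 → Fin K, hamStar σ τ = 0 := fun σ τ =>
      Nat.le_zero.1 (hamStar_le_card σ τ)
    simp [h0]
  have hKpos : 0 < K := by
    have : Nonempty S := by
      by_contra hS
      rw [not_nonempty_iff] at hS
      simp at hf1
    exact (σhat (fun _ => Classical.arbitrary S) ⟨0, hN⟩).pos
  rcases (show K = 1 ∨ 2 ≤ K by omega) with rfl | hK
  · have h0 : ∀ σ τ : Fin N → Fin 1, hamStar σ τ = 0 := by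
      intro σ τ
      refine Nat.le_zero.1 ((hamStar_le σ τ 1).trans ?_)
      have : σ = fun i => (1 : Equiv.Perm (Fin 1)) (τ i) := Subsingleton.elim _ _
      rw [← this]
      simp [ham]
    simp only [h0, Nat.cast_zero, mul_zero, sum_const_zero]
    simp only [Nat.cast_one, sub_self, mul_zero, zero_mul, zero_add]
    positivity
  have hK' : (2 : ℝ) ≤ K := by exact_mod_cast hK
  have hN' : (1 : ℝ) ≤ N := by exact_mod_cast hN
  have hK1 : (1 : ℝ) ≤ (K : ℝ) - 1 := by linarith
  have hb0 : 0 ≤ ∑ x, √(f x * g x) := sum_nonneg fun _ _ => Real.sqrt_nonneg _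
  have hb1 := sum_sqrt_mul_le_one hf0 hg0 hf1 hg1
  have hI0 : 0 ≤ I := by
    have := Real.log_nonpos hb0 hb1
    linarith
  set n : ℝ := (N : ℝ) / K with hn
  have hn0 : 0 < n := by positivity
  have hnI : (N : ℝ) * I / K = n * I := by rw [hn]; ring
  rw [hnI] at hκ ⊢
  set B := Real.exp 1 * N * ((K : ℝ) - 1) * Real.exp (-(1 - ζ - κ) * (n * I)) with hB
  have hB0 : 0 ≤ B := by positivity
  have hBeq : 8 * Real.exp 1 * N * ((K : ℝ) - 1) * Real.exp (-(1 - ζ - κ) * (n * I)) = 8 * B := by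
    rw [hB]; ring
  rw [hBeq]
  have hErr := sum_sbmProb_mul_hamStar_le hf0 hg0 hf1 hg1 σhat
  set h : (Fin N → Fin K) → ℝ := fun σ => ∑ x, sbmProb f g σ x * (hamStar σ (σhat x) : ℝ) with hh
  have hKN : (0 : ℝ) < (K : ℝ) ^ N := by positivity
  by_cases hbzero : ∑ x, √(f x * g x) = 0
  · have hIz : I = 0 := by rw [hI, hbzero]; simp
    have h1 := average_le_add hKpos (fun _ => True) (h := h) (Nat.cast_nonneg N)
      (fun σ _ => hErr σ) hErr
    simp only [not_true_eq_false, filter_false, card_empty, Nat.cast_zero, mul_zero,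
      add_zero] at h1
    have h2 : (N : ℝ) ≤ B := by
      rw [hB, hIz]
      have h13 : (1 : ℝ) ≤ Real.exp 1 := Real.one_le_exp (by norm_num)
      simp only [mul_zero, Real.exp_zero, mul_one]
      calc (N : ℝ) = 1 * N * 1 := by ring
        _ ≤ _ := by gcongr
    refine h1.trans ?_
    have h3 : 0 ≤ (N : ℝ) * (K : ℝ) ^ N *
          Real.exp (-(1 / 4) * (ζ / ((K : ℝ) - 1) - ε) * n ^ 2 * I) := by positivity
    have h4 : 0 ≤ 2 * (N : ℝ) * K * Real.exp (-(1 / 3) * ε ^ 2 * (N : ℝ) / K) := by positivity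
    linarith
  have hb : ∑ x, √(f x * g x) = Real.exp (-(1 / 2) * I) := by
    rw [hI, show -(1 / 2) * (-2 * Real.log (∑ x, √(f x * g x))) =
      Real.log (∑ x, √(f x * g x)) by ring, Real.exp_log (lt_of_le_of_ne hb0 (Ne.symm hbzero))]
  have hκ1 : 56 * ((K : ℝ) ^ 2 * Real.exp (-(1 / 8) * (n * I))) ≤ κ := by
    rw [hκ]
    gcongr
    exact le_max_left _ _
  have hκ2 : 56 ≤ κ * n := by
    have h1 : 56 * ((K : ℝ) / N) ≤ κ := by
      rw [hκ]
      gcongr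
      exact le_max_right _ _
    calc (56 : ℝ) = 56 * ((K : ℝ) / N) * n := by rw [hn]; field_simp
      _ ≤ _ := by gcongr
  have hmain := average_le_add hKpos (fun σ => ∀ k, (1 - ε) * n ≤ (blockCount σ k : ℝ)) (h := h)
    (A := 4 * B +
      N * ((K : ℝ) ^ N * Real.exp (-(1 / 4) * (ζ / ((K : ℝ) - 1) - ε) * n ^ 2 * I)))
    (by positivity)
    (fun σ hσ => balanced_error_le hf0 hg0 hf1 hg1 hb hMLE hK hN hI0 hn hε0 hεζ hζ hκ1 hκ2 hB
      hB0 σ hσ) hErr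
  refine hmain.trans ?_
  have hcard := card_unbalanced_le (N := N) hK hε0 (hεζ.trans hζ)
  rw [← hn] at hcard
  have h1 : ((K : ℝ) ^ N)⁻¹ * (N * ((univ.filter fun σ : Fin N → Fin K =>
      ¬∀ k, (1 - ε) * n ≤ (blockCount σ k : ℝ)).card : ℝ)) ≤
      N * K * Real.exp (-(1 / 3) * ε ^ 2 * n) := by
    rw [inv_mul_le_iff₀ hKN]
    calc _ ≤ N * (K * ((K : ℝ) ^ N * Real.exp (-(1 / 3) * ε ^ 2 * n))) := by gcongr
      _ = _ := by ring
  have h2 : -(1 / 3) * ε ^ 2 * (N : ℝ) / K = -(1 / 3) * ε ^ 2 * n := by rw [hn]; ring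
  rw [h2]
  have h3 : 0 ≤ N * K * Real.exp (-(1 / 3) * ε ^ 2 * n) := by positivity
  linarith
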